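/- arXiv:1808.03999 — 5 statements merged into one kernel-verified Lean document; each statement's English description precedes it below -/
import Mathlib

section
/- Let R be a real 3×3 special orthogonal matrix with columns r₁, r₂, r₃ and let A be its cross tensor, A_{ijkl} = ∑_{q=1}^{3} R_{iq} R_{jq} R_{kq} R_{lq}. If D is a symmetric real 3×3 matrix satisfying A : D = D, then D is a linear combination of the matrices r_q ⊗ r_q: there exist real numbers c₁, c₂, c₃ such that D = c₁ r₁⊗r₁ + c₂ r₂⊗r₂ + c₃ r₃⊗r₃. In particular each column r_q of R is an eigenvector of D. -/
open Matrix

/-- The cross tensor of a 3×3 matrix `R`: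
`A i j k l = ∑ q, R i q * R j q * R k q * R l q`. -/
def crossTensor (R : Matrix (Fin 3) (Fin 3) ℝ) (i j k l : Fin 3) : ℝ :=
  ∑ q : Fin 3, R i q * R j q * R k q * R l q

/-- Contracting the cross tensor of `R` with `D` gives a combination of the matrices
`r_q ⊗ r_q`, with the values of the quadratic form of `D` at `r_q` as coefficients. -/
theorem crossTensor_contract (R D : Matrix (Fin 3) (Fin 3) ℝ) (i j : Fin 3) :
    ∑ k, ∑ l, crossTensor R i j k l * D k l =
      ∑ q, (∑ k, ∑ l, R k q * R l q * D k l) * (R i q * R j q) := by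
  simp only [crossTensor, Fin.sum_univ_three]
  ring

/-- A combination of the matrices `r_q ⊗ r_q` with orthonormal columns `r_q` has every
`r_q` as an eigenvector. -/
theorem mulVec_col_of_eq_sum_columns {n : Type*} [Fintype n] [DecidableEq n]
    {R D : Matrix n n ℝ} (horth : Rᵀ * R = 1) {c : n → ℝ}
    (hD : ∀ i j, D i j = ∑ q, c q * (R i q * R j q)) (q : n) :
    D.mulVec (fun i => R i q) = c q • (fun i => R i q) := by
  have hfac : D = R * diagonal c * Rᵀ := by
    ext i j
    rw [hD, mul_apply]
    refine Finset.sum_congr rfl fun p _ => ?_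
    rw [mul_diagonal, transpose_apply]
    ring
  have hmul : D * R = R * diagonal c := by
    rw [hfac, Matrix.mul_assoc, horth, Matrix.mul_one]
  ext i
  have hiq : (D * R) i q = (R * diagonal c) i q := by rw [hmul]
  rw [mul_diagonal, mul_comm] at hiq
  exact hiq

/-- For `R ∈ SO(3)` with columns `r_q` (so `(r_q)_i = R i q`), any symmetric
matrix `D` fixed by the contraction with the cross tensor (`A : D = D`) is a
linear combination `D = ∑ q, c q • r_q ⊗ r_q`; in particular every column
`r_q` of `R` is an eigenvector of `D`. -/
theorem crossTensor_fixed_symmetric_is_combination_of_columns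
    (R : Matrix (Fin 3) (Fin 3) ℝ) (horth : Rᵀ * R = 1) (hdet : R.det = 1)
    (D : Matrix (Fin 3) (Fin 3) ℝ) (hDsym : Dᵀ = D)
    (hfix : ∀ i j : Fin 3,
      ∑ k : Fin 3, ∑ l : Fin 3, crossTensor R i j k l * D k l = D i j) :
    ∃ c : Fin 3 → ℝ,
      (∀ i j : Fin 3, D i j = ∑ q : Fin 3, c q * (R i q * R j q)) ∧
      (∀ q : Fin 3, D.mulVec (fun i => R i q) = c q • (fun i => R i q)) := by
  have hD : ∀ i j : Fin 3, D i j =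
      ∑ q, (∑ k, ∑ l, R k q * R l q * D k l) * (R i q * R j q) := fun i j => by
    rw [← crossTensor_contract, hfix]
  exact ⟨_, hD, mulVec_col_of_eq_sum_columns horth hD⟩
end

section
/- Let A be a fully symmetric 4th-order tensor on ℝ³ satisfying the partial trace condition ∑_{i=1}^{3} A_{iikl} = δ_{kl} for all k,l, and suppose A is a projector onto a 3-dimensional subspace of symmetric matrices: there exist symmetric real 3×3 matrices dᵃ, dᵇ, dᶜ, orthonormal with respect to the Frobenius inner product, such that A_{ijkl} = dᵃ_{ij} dᵃ_{kl} + dᵇ_{ij} dᵇ_{kl} + dᶜ_{ij} dᶜ_{kl}. Then A is the tensor of a cross attitude: there exists an orthonormal basis (r₁, r₂, r₃) of ℝ³ such that A_{ijkl} = ∑_{q=1}^{3} (r_q)_i (r_q)_j (r_q)_k (r_q)_l for all i,j,k,l. -/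
open Matrix

/-- The Frobenius inner product of real 3×3 matrices. -/
def frobInner (a b : Matrix (Fin 3) (Fin 3) ℝ) : ℝ :=
  ∑ i : Fin 3, ∑ j : Fin 3, a i j * b i j

/-- Pairwise commuting real symmetric matrices are diagonalized by a single orthogonal matrix. -/
theorem exists_orthogonal_diagonalization_of_commute {ι n : Type*} [Fintype n] [DecidableEq n]
    (d : ι → Matrix n n ℝ) (hd : ∀ m, (d m)ᵀ = d m) (hc : ∀ m p, Commute (d m) (d p)) :
    ∃ (U : Matrix n n ℝ) (L : ι → n → ℝ),
      U * Uᵀ = 1 ∧ ∀ m, d m = Uᵀ * diagonal (L m) * U := by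
  classical
  let T : ι → Module.End ℝ (EuclideanSpace ℝ n) := fun m => toEuclideanLin (d m)
  have hT : ∀ m, (T m).IsSymmetric := fun m =>
    isSymmetric_toEuclideanLin_iff.mpr (by simpa [IsHermitian] using hd m)
  have hTC : Pairwise (Function.onFun Commute T) := by
    intro m p _
    refine LinearMap.ext fun v => ?_
    simp only [T, Module.End.mul_apply, toLpLin_apply, mulVec_mulVec, (hc m p).eq]
  have hV := LinearMap.IsSymmetric.orthogonalFamily_iInf_eigenspaces hT
  have hI := LinearMap.IsSymmetric.directSum_isInternal_of_pairwise_commute hT hTC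
  let v := fun γ : ι → ℝ =>
    stdOrthonormalBasis ℝ (⨅ j, Module.End.eigenspace (T j) (γ j) : Submodule ℝ _)
  let B := hI.collectedBasis fun γ => (v γ).toBasis
  have hB : Orthonormal ℝ B := hI.collectedBasis_orthonormal hV fun γ => by simp
  let e := B.indexEquiv (EuclideanSpace.basisFun n ℝ).toBasis
  let b : n → EuclideanSpace ℝ n := fun q => B (e.symm q)
  have hb : Orthonormal ℝ b := hB.comp _ e.symm.injective
  let U : Matrix n n ℝ := of fun q i => b q i
  have hU : U * Uᵀ = 1 := by
    ext p q
    have h := orthonormal_iff_ite.mp hb q p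
    simp only [PiLp.inner_apply, RCLike.inner_apply, conj_trivial] at h
    simpa [U, mul_apply, one_apply, eq_comm] using h
  refine ⟨U, fun m q => (e.symm q).1 m, hU, fun m => ?_⟩
  have h : d m * Uᵀ = Uᵀ * diagonal fun q => (e.symm q).1 m := by
    ext i q
    have hq : T m (b q) = (e.symm q).1 m • b q :=
      Module.End.mem_eigenspace_iff.mp
        ((Submodule.mem_iInf _).mp (hI.collectedBasis_mem _ (e.symm q)) m)
    rw [mul_diagonal, mul_comm]
    exact congrArg (fun x : EuclideanSpace ℝ n => x i) hq
  rw [← h, Matrix.mul_assoc, mul_eq_one_comm.mp hU, Matrix.mul_one]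

/-- If the projector `∑ m, d m ⊗ d m` onto the span of Frobenius-orthonormal symmetric matrices is
invariant under a cyclic permutation of its last three indices and `∑ m, d m * d m = 1`, then the
matrices `d m` commute. -/
theorem commute_of_symmetric_projector {ι n : Type*} [Fintype ι] [DecidableEq ι] [Fintype n]
    [DecidableEq n] (d : ι → Matrix n n ℝ) (hd : ∀ m, (d m)ᵀ = d m)
    (horth : ∀ m p, (d m * d p).trace = if m = p then 1 else 0)
    (hsymm : ∀ i j k l, ∑ m, d m i j * d m k l = ∑ m, d m i l * d m j k)
    (hone : ∑ m, d m * d m = 1) (m p : ι) : Commute (d m) (d p) := by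
  have hsandwich : ∑ m, d m * d p * d m = d p := by
    ext i l
    calc (∑ m, d m * d p * d m) i l
        = ∑ k, ∑ j, (∑ m, d m i j * d m k l) * d p j k := by
          simp only [Matrix.sum_apply, mul_apply, Finset.sum_mul]
          rw [Finset.sum_comm]
          refine Finset.sum_congr rfl fun k _ => ?_
          rw [Finset.sum_comm]
          exact Finset.sum_congr rfl fun j _ => Finset.sum_congr rfl fun m _ => by ring
      _ = ∑ m, d m i l * (d m * d p).trace := by
          simp only [hsymm, trace, diag_apply, mul_apply, Finset.mul_sum, Finset.sum_mul]
          rw [Finset.sum_comm]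
          simp_rw [Finset.sum_comm (t := (Finset.univ : Finset ι))]
          refine Finset.sum_congr rfl fun m _ => Finset.sum_congr rfl fun j _ =>
            Finset.sum_congr rfl fun k _ => ?_
          rw [show d p j k = d p k j from congrFun (congrFun (hd p) k) j]
          ring
      _ = d p i l := by simp [horth]
  let C : ι → Matrix n n ℝ := fun m => d m * d p - d p * d m
  have hsum : ∑ m, ((C m)ᵀ * C m).trace = 0 := by
    have hC : ∀ m, ((C m)ᵀ * C m).trace =
        2 * (d m * d m * (d p * d p)).trace - 2 * (d m * d p * d m * d p).trace := by
      intro m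
      have h₁ : (d p * (d m * (d m * d p))).trace = (d m * (d m * (d p * d p))).trace := by
        rw [trace_mul_comm]; simp only [Matrix.mul_assoc]
      have h₂ : (d p * (d m * (d p * d m))).trace = (d m * (d p * (d m * d p))).trace := by
        rw [trace_mul_comm]; simp only [Matrix.mul_assoc]
      have h₃ : (d m * (d p * (d p * d m))).trace = (d m * (d m * (d p * d p))).trace := by
        rw [← Matrix.mul_assoc (d p), ← Matrix.mul_assoc (d m), trace_mul_comm]
      simp only [C, transpose_sub, transpose_mul, hd, Matrix.sub_mul, Matrix.mul_sub,
        Matrix.mul_assoc, trace_sub, h₁, h₂, h₃]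
      ring
    simp only [hC, Finset.sum_sub_distrib, ← Finset.mul_sum, ← trace_sum, ← Finset.sum_mul,
      hone, hsandwich, Matrix.one_mul, sub_self]
  have hnonneg : ∀ m ∈ Finset.univ, 0 ≤ ((C m)ᵀ * C m).trace := fun m _ => by
    simpa using (posSemidef_conjTranspose_mul_self (C m)).trace_nonneg
  have hzero := (Finset.sum_eq_zero_iff_of_nonneg hnonneg).mp hsum m (Finset.mem_univ m)
  exact sub_eq_zero.mp (trace_conjTranspose_mul_self_eq_zero_iff.mp (by
    rwa [conjTranspose_eq_transpose_of_trivial]))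

/-- A projector `∑ m, d m ⊗ d m` onto the span of as many simultaneously diagonalized
Frobenius-orthonormal matrices as the dimension is the sum of the fourth tensor powers of the
common eigenvectors. -/
theorem projector_eq_sum_of_diagonalization {n : Type*} [Fintype n] [DecidableEq n]
    (d : n → Matrix n n ℝ) (horth : ∀ m p, (d m * d p).trace = if m = p then 1 else 0)
    (U : Matrix n n ℝ) (L : n → n → ℝ) (hU : U * Uᵀ = 1)
    (hd : ∀ m, d m = Uᵀ * diagonal (L m) * U) (i j k l : n) :
    ∑ m, d m i j * d m k l = ∑ q, U q i * U q j * U q k * U q l := by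
  have hL : of L * (of L)ᵀ = 1 := by
    ext m p
    rw [one_apply, ← horth m p, hd, hd]
    have h : Uᵀ * diagonal (L m) * U * (Uᵀ * diagonal (L p) * U) =
        Uᵀ * (diagonal (L m) * diagonal (L p) * U) := by
      simp only [Matrix.mul_assoc]
      rw [← Matrix.mul_assoc U, hU, Matrix.one_mul]
    rw [h, trace_mul_comm, Matrix.mul_assoc, hU, Matrix.mul_one, diagonal_mul_diagonal,
      trace_diagonal]
    simp [mul_apply]
  have hL' : ∀ q s, ∑ m, L m q * L m s = if q = s then 1 else 0 := fun q s => by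
    have h : (of L)ᵀ * of L = 1 := mul_eq_one_comm.mp hL
    simpa [mul_apply, one_apply] using congrFun (congrFun h q) s
  have hentry : ∀ m i j, d m i j = ∑ q, L m q * (U q i * U q j) := fun m i j => by
    rw [hd, mul_apply]
    exact Finset.sum_congr rfl fun q _ => by rw [mul_diagonal, transpose_apply]; ring
  calc ∑ m, d m i j * d m k l
      = ∑ q, ∑ s, (∑ m, L m q * L m s) * (U q i * U q j * (U s k * U s l)) := by
        simp only [hentry, Finset.sum_mul_sum]
        simp only [Finset.sum_mul]
        rw [Finset.sum_comm]
        refine Finset.sum_congr rfl fun q _ => ?_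
        rw [Finset.sum_comm]
        exact Finset.sum_congr rfl fun s _ => Finset.sum_congr rfl fun m _ => by ring
    _ = ∑ q, U q i * U q j * U q k * U q l := by simp [hL', mul_assoc]

/-- A fully symmetric 4th-order tensor on ℝ³ with partial traces
`∑ i, A i i k l = δ k l` that is a projector onto a 3-dimensional subspace of
symmetric matrices (i.e. `A = dᵃ⊗dᵃ + dᵇ⊗dᵇ + dᶜ⊗dᶜ` for Frobenius-orthonormal
symmetric matrices `dᵃ, dᵇ, dᶜ`) is the tensor of a cross attitude: there is an
orthonormal basis `(r₁, r₂, r₃)` of ℝ³ with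
`A i j k l = ∑ q, (r q) i * (r q) j * (r q) k * (r q) l`. -/
theorem projector_tensor_is_cross_attitude
    (A : Fin 3 → Fin 3 → Fin 3 → Fin 3 → ℝ)
    (hsym : ∀ (σ : Equiv.Perm (Fin 4)) (v : Fin 4 → Fin 3),
      A (v (σ 0)) (v (σ 1)) (v (σ 2)) (v (σ 3)) = A (v 0) (v 1) (v 2) (v 3))
    (htrace : ∀ k l : Fin 3,
      ∑ i : Fin 3, A i i k l = if k = l then (1 : ℝ) else 0)
    (da db dc : Matrix (Fin 3) (Fin 3) ℝ)
    (hda : daᵀ = da) (hdb : dbᵀ = db) (hdc : dcᵀ = dc)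
    (haa : frobInner da da = 1) (hbb : frobInner db db = 1)
    (hcc : frobInner dc dc = 1)
    (hab : frobInner da db = 0) (hac : frobInner da dc = 0)
    (hbc : frobInner db dc = 0)
    (hdecomp : ∀ i j k l : Fin 3,
      A i j k l = da i j * da k l + db i j * db k l + dc i j * dc k l) :
    ∃ r : Fin 3 → (Fin 3 → ℝ),
      (∀ p q : Fin 3,
        ∑ i : Fin 3, r p i * r q i = if p = q then (1 : ℝ) else 0) ∧
      (∀ i j k l : Fin 3,
        A i j k l = ∑ q : Fin 3, r q i * r q j * r q k * r q l) := by
  let d : Fin 3 → Matrix (Fin 3) (Fin 3) ℝ := ![da, db, dc]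
  have hA : ∀ i j k l, A i j k l = ∑ m, d m i j * d m k l := fun i j k l => by
    rw [Fin.sum_univ_three]
    exact hdecomp i j k l
  have hd : ∀ m, (d m)ᵀ = d m := fun m => by fin_cases m <;> assumption
  have hfrob : ∀ a b : Matrix (Fin 3) (Fin 3) ℝ, bᵀ = b → (a * b).trace = frobInner a b :=
    fun a b hb => by
      conv_lhs => rw [← hb]
      simp [trace, mul_apply, frobInner]
  have hcomm : ∀ a b, frobInner a b = frobInner b a := fun a b => by
    simp only [frobInner, mul_comm]
  have horth : ∀ m p, (d m * d p).trace = if m = p then 1 else 0 := fun m p => by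
    rw [hfrob _ _ (hd p)]
    exact match m, p with
      | 0, 0 => haa
      | 0, 1 => hab
      | 0, 2 => hac
      | 1, 0 => (hcomm db da).trans hab
      | 1, 1 => hbb
      | 1, 2 => hbc
      | 2, 0 => (hcomm dc da).trans hac
      | 2, 1 => (hcomm dc db).trans hbc
      | 2, 2 => hcc
  have hcycle : ∀ i j k l, A i j k l = A i l j k := fun i j k l =>
    hsym ⟨![0, 2, 3, 1], ![0, 3, 1, 2], by decide, by decide⟩ ![i, l, j, k]
  have hpair : ∀ i j k l, A i j k l = A k l i j := fun i j k l =>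
    hsym ⟨![2, 3, 0, 1], ![2, 3, 0, 1], by decide, by decide⟩ ![k, l, i, j]
  have hone : ∑ m, d m * d m = 1 := by
    ext i l
    simp only [Matrix.sum_apply, mul_apply]
    rw [Finset.sum_comm, one_apply, ← htrace i l]
    exact Finset.sum_congr rfl fun j _ => by rw [← hA, hcycle, hpair]
  obtain ⟨U, L, hU, hdiag⟩ := exists_orthogonal_diagonalization_of_commute d hd
    (commute_of_symmetric_projector d hd horth
      (fun i j k l => by rw [← hA, ← hA, hcycle]) hone)
  refine ⟨U, fun p q => ?_, fun i j k l => ?_⟩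
  · simpa [mul_apply, one_apply] using congrFun (congrFun hU p) q
  · rw [hA, projector_eq_sum_of_diagonalization d horth U L hU hdiag]
end

section
/- Let A be a fully symmetric 4th-order tensor on ℝ³ satisfying the partial trace condition ∑_{i=1}^{3} A_{iikl} = δ_{kl}, and suppose there exist symmetric real 3×3 matrices dᵃ, dᵇ, dᶜ, orthonormal with respect to the Frobenius inner product, such that A_{ijkl} = dᵃ_{ij} dᵃ_{kl} + dᵇ_{ij} dᵇ_{kl} + dᶜ_{ij} dᶜ_{kl}. Then the matrices dᵃ, dᵇ, dᶜ pairwise commute: dᵃ dᵇ = dᵇ dᵃ, dᵃ dᶜ = dᶜ dᵃ, and dᵇ dᶜ = dᶜ dᵇ. -/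
open Matrix

/-- A symmetric fixed point of the unital map `X ↦ ∑ a, d a * X * d a`, with all `d a` symmetric,
commutes with every `d a`. -/
theorem commute_of_sum_mul_mul_eq_self {ι n : Type*} [Fintype ι] [Fintype n] [DecidableEq n]
    (d : ι → Matrix n n ℝ) (X : Matrix n n ℝ) (hd : ∀ a, (d a)ᵀ = d a) (hX : Xᵀ = X)
    (hone : ∑ a, d a * d a = 1) (hfix : ∑ a, d a * X * d a = X) (a : ι) :
    Commute X (d a) := by
  have htr (a : ι) : trace ((X * d a - d a * X) * (X * d a - d a * X)ᵀ) =
      2 * trace (X * X * (d a * d a)) - 2 * trace (X * (d a * X * d a)) := by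
    have h₁ : trace (X * d a * (d a * X)) = trace (X * X * (d a * d a)) := by
      rw [← Matrix.mul_assoc, trace_mul_comm]
      simp only [Matrix.mul_assoc]
    have h₂ : trace (d a * X * (X * d a)) = trace (X * X * (d a * d a)) := by
      rw [trace_mul_comm, h₁]
    have h₃ : trace (d a * X * (d a * X)) = trace (X * (d a * X * d a)) := by
      rw [← Matrix.mul_assoc, trace_mul_comm]
    have h₄ : trace (X * d a * (X * d a)) = trace (X * (d a * X * d a)) := by
      simp only [Matrix.mul_assoc]
    rw [transpose_sub, transpose_mul, transpose_mul, hd, hX, Matrix.sub_mul, Matrix.mul_sub,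
      Matrix.mul_sub, trace_sub, trace_sub, trace_sub, h₁, h₂, h₃, h₄]
    ring
  have hsum : ∑ a, trace ((X * d a - d a * X) * (X * d a - d a * X)ᵀ) = 0 := by
    simp only [htr, Finset.sum_sub_distrib, ← Finset.mul_sum, ← trace_sum, hone, hfix,
      Matrix.mul_one, sub_self]
  have hnonneg (a : ι) : 0 ≤ trace ((X * d a - d a * X) * (X * d a - d a * X)ᵀ) := by
    simpa using (posSemidef_self_mul_conjTranspose (X * d a - d a * X)).trace_nonneg
  have hzero := (Finset.sum_eq_zero_iff_of_nonneg fun a _ => hnonneg a).1 hsum a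
    (Finset.mem_univ a)
  rw [← conjTranspose_eq_transpose_of_trivial, trace_mul_conjTranspose_self_eq_zero_iff] at hzero
  exact sub_eq_zero.1 hzero

/-- If a fully symmetric 4th-order tensor on ℝ³ with partial traces
`∑ i, A i i k l = δ k l` decomposes as `A = dᵃ⊗dᵃ + dᵇ⊗dᵇ + dᶜ⊗dᶜ` with
Frobenius-orthonormal symmetric matrices `dᵃ, dᵇ, dᶜ`, then these matrices
pairwise commute. -/
theorem projector_tensor_eigentensors_commute
    (A : Fin 3 → Fin 3 → Fin 3 → Fin 3 → ℝ)
    (hsym : ∀ (σ : Equiv.Perm (Fin 4)) (v : Fin 4 → Fin 3),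
      A (v (σ 0)) (v (σ 1)) (v (σ 2)) (v (σ 3)) = A (v 0) (v 1) (v 2) (v 3))
    (htrace : ∀ k l : Fin 3,
      ∑ i : Fin 3, A i i k l = if k = l then (1 : ℝ) else 0)
    (da db dc : Matrix (Fin 3) (Fin 3) ℝ)
    (hda : daᵀ = da) (hdb : dbᵀ = db) (hdc : dcᵀ = dc)
    (haa : frobInner da da = 1) (hbb : frobInner db db = 1)
    (hcc : frobInner dc dc = 1)
    (hab : frobInner da db = 0) (hac : frobInner da dc = 0)
    (hbc : frobInner db dc = 0)
    (hdecomp : ∀ i j k l : Fin 3,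
      A i j k l = da i j * da k l + db i j * db k l + dc i j * dc k l) :
    da * db = db * da ∧ da * dc = dc * da ∧ db * dc = dc * db := by
  have hswap (i j k l : Fin 3) : A i j k l = A i l j k := by
    have h := hsym (Equiv.swap 1 3 * Equiv.swap 2 3) ![i, j, k, l]
    have e1 : (Equiv.swap 1 3 * Equiv.swap 2 3 : Equiv.Perm (Fin 4)) 0 = 0 := by decide
    have e2 : (Equiv.swap 1 3 * Equiv.swap 2 3 : Equiv.Perm (Fin 4)) 1 = 3 := by decide
    have e3 : (Equiv.swap 1 3 * Equiv.swap 2 3 : Equiv.Perm (Fin 4)) 2 = 1 := by decide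
    have e4 : (Equiv.swap 1 3 * Equiv.swap 2 3 : Equiv.Perm (Fin 4)) 3 = 2 := by decide
    rw [e1, e2, e3, e4] at h
    exact h.symm
  let d : Fin 3 → Matrix (Fin 3) (Fin 3) ℝ := ![da, db, dc]
  have hd (a : Fin 3) : (d a)ᵀ = d a := by
    fin_cases a <;> assumption
  have hA (i j k l : Fin 3) : A i j k l = ∑ a, d a i j * d a k l := by
    rw [hdecomp, Fin.sum_univ_three]
    rfl
  have hcomm (a b : Fin 3) : frobInner (d a) (d b) = frobInner (d b) (d a) := by
    simp only [frobInner, mul_comm]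
  have horth (a b : Fin 3) : frobInner (d a) (d b) = if a = b then 1 else 0 := by
    fin_cases a <;> fin_cases b <;>
      first
      | assumption
      | (rw [hcomm]; assumption)
  have hone : ∑ a, d a * d a = 1 := by
    ext i l
    have h : (∑ a, d a * d a) i l = ∑ k, A i k k l := by
      simp only [Matrix.sum_apply, Matrix.mul_apply, hA]
      exact Finset.sum_comm
    rw [h, one_apply, ← htrace]
    refine Finset.sum_congr rfl fun k _ => ?_
    rw [hswap, hA, hA]
    exact Finset.sum_congr rfl fun a _ => mul_comm _ _
  have hfix (b : Fin 3) : ∑ a, d a * d b * d a = d b := by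
    ext i l
    have h : (∑ a, d a * d b * d a) i l = ∑ j, ∑ k, A i j k l * d b j k := by
      simp only [Matrix.sum_apply, Matrix.mul_apply, hA, Fin.sum_univ_three]
      ring
    have h' : ∑ j, ∑ k, A i j k l * d b j k = ∑ a, d a i l * frobInner (d a) (d b) := by
      simp only [hswap i _ _ l, hA, frobInner, Fin.sum_univ_three]
      ring
    rw [h, h']
    simp [horth]
  have key (a b : Fin 3) : d a * d b = d b * d a :=
    commute_of_sum_mul_mul_eq_self d (d a) hd (hd a) hone (hfix a) b
  exact ⟨key 0 1, key 0 2, key 1 2⟩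
end

section
/- Let A be a fully symmetric 4th-order tensor on ℝ³ and suppose there exist symmetric real 3×3 matrices dᵃ, dᵇ, dᶜ, orthonormal with respect to the Frobenius inner product, such that A_{ijkl} = dᵃ_{ij} dᵃ_{kl} + dᵇ_{ij} dᵇ_{kl} + dᶜ_{ij} dᶜ_{kl}. Then dᵃ = (dᵃ)³ + dᵇ dᵃ dᵇ + dᶜ dᵃ dᶜ, and consequently (dᵃ)² = (dᵃ)⁴ + (dᵃ dᵇ)² + (dᵃ dᶜ)². -/
open Matrix

/-- Contracting a sum of squares of an orthonormal triple with `a` gives back `a`. -/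
theorem sum_sum_mul_eq_of_frobInner {a b c : Matrix (Fin 3) (Fin 3) ℝ}
    (haa : frobInner a a = 1) (hab : frobInner a b = 0) (hac : frobInner a c = 0)
    (i j : Fin 3) :
    ∑ k, ∑ l, (a i j * a k l + b i j * b k l + c i j * c k l) * a k l = a i j := by
  simp only [frobInner, Fin.sum_univ_three] at haa hab hac ⊢
  linear_combination a i j * haa + b i j * hab + c i j * hac

/-- The entries of `x * y * x` for symmetric `x`. -/
theorem mul_mul_apply_of_transpose_eq {x : Matrix (Fin 3) (Fin 3) ℝ} (hx : xᵀ = x)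
    (y : Matrix (Fin 3) (Fin 3) ℝ) (i j : Fin 3) :
    (x * y * x) i j = ∑ k, ∑ l, x i k * x j l * y k l := by
  have hx' (l : Fin 3) : x l j = x j l := congrFun₂ hx j l
  simp only [Matrix.mul_apply, hx', Fin.sum_univ_three]
  ring

/-- If a fully symmetric 4th-order tensor on ℝ³ decomposes as
`A = dᵃ⊗dᵃ + dᵇ⊗dᵇ + dᶜ⊗dᶜ` with Frobenius-orthonormal symmetric matrices
`dᵃ, dᵇ, dᶜ`, then `dᵃ = (dᵃ)³ + dᵇ dᵃ dᵇ + dᶜ dᵃ dᶜ` and consequently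
`(dᵃ)² = (dᵃ)⁴ + (dᵃ dᵇ)² + (dᵃ dᶜ)²`. -/
theorem eigentensor_cubic_identity
    (A : Fin 3 → Fin 3 → Fin 3 → Fin 3 → ℝ)
    (hsym : ∀ (σ : Equiv.Perm (Fin 4)) (v : Fin 4 → Fin 3),
      A (v (σ 0)) (v (σ 1)) (v (σ 2)) (v (σ 3)) = A (v 0) (v 1) (v 2) (v 3))
    (da db dc : Matrix (Fin 3) (Fin 3) ℝ)
    (hda : daᵀ = da) (hdb : dbᵀ = db) (hdc : dcᵀ = dc)
    (haa : frobInner da da = 1) (hbb : frobInner db db = 1)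
    (hcc : frobInner dc dc = 1)
    (hab : frobInner da db = 0) (hac : frobInner da dc = 0)
    (hbc : frobInner db dc = 0)
    (hdecomp : ∀ i j k l : Fin 3,
      A i j k l = da i j * da k l + db i j * db k l + dc i j * dc k l) :
    da = da ^ 3 + db * da * db + dc * da * dc ∧
    da ^ 2 = da ^ 4 + (da * db) ^ 2 + (da * dc) ^ 2 := by
  have hswap (i j k l : Fin 3) : A i j k l = A i k j l :=
    hsym (Equiv.swap 1 2) ![i, k, j, l]
  have hcubic : da = da ^ 3 + db * da * db + dc * da * dc := by
    ext i j
    rw [pow_succ, sq, Matrix.add_apply, Matrix.add_apply,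
      mul_mul_apply_of_transpose_eq hda, mul_mul_apply_of_transpose_eq hdb,
      mul_mul_apply_of_transpose_eq hdc, ← sum_sum_mul_eq_of_frobInner haa hab hac i j]
    simp only [← Finset.sum_add_distrib, ← add_mul, ← hdecomp, hswap i j]
  refine ⟨hcubic, ?_⟩
  calc da ^ 2 = da * da := sq da
    _ = da * (da ^ 3 + db * da * db + dc * da * dc) := by rw [← hcubic]
    _ = da ^ 4 + (da * db) ^ 2 + (da * dc) ^ 2 := by noncomm_ring
end

section
/- Let dᵃ, dᵇ, dᶜ be symmetric real 3×3 matrices that are orthonormal with respect to the Frobenius inner product and pairwise commute. Then there exists an orthonormal basis (r₁, r₂, r₃) of ℝ³ such that the 4th-order tensor A with components A_{ijkl} = dᵃ_{ij} dᵃ_{kl} + dᵇ_{ij} dᵇ_{kl} + dᶜ_{ij} dᶜ_{kl} satisfies A_{ijkl} = ∑_{q=1}^{3} (r_q)_i (r_q)_j (r_q)_k (r_q)_l for all i,j,k,l ∈ {1,2,3}. -/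
open Matrix

/-- A commuting family of symmetric real matrices has a common orthonormal eigenbasis. -/
theorem exists_orthonormalBasis_eigenvectors_of_commute {ι : Type*} [Finite ι] {n : ℕ}
    (D : ι → Matrix (Fin n) (Fin n) ℝ) (hD : ∀ l, (D l).IsSymm)
    (hC : ∀ l m, Commute (D l) (D m)) :
    ∃ (b : OrthonormalBasis (Fin n) ℝ (EuclideanSpace ℝ (Fin n))) (c : ι → Fin n → ℝ),
      ∀ l q, D l *ᵥ (b q).ofLp = c l q • (b q).ofLp := by
  classical
  let T : ι → EuclideanSpace ℝ (Fin n) →ₗ[ℝ] EuclideanSpace ℝ (Fin n) :=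
    fun l => toEuclideanLin (D l)
  have hT : ∀ l, (T l).IsSymmetric := fun l =>
    isSymmetric_toEuclideanLin_iff.2
      (by rw [IsHermitian, conjTranspose_eq_transpose_of_trivial]; exact hD l)
  have hTC : ∀ l m, Commute (T l) (T m) := fun l m => by
    ext1 v
    simp [T, toLpLin_apply, (hC l m).eq]
  let V : (ι → ℝ) → Submodule ℝ (EuclideanSpace ℝ (Fin n)) :=
    fun χ => ⨅ l, Module.End.eigenspace (T l) (χ l)
  have hV' := LinearMap.IsSymmetric.orthogonalFamily_iInf_eigenspaces hT
  have hV : DirectSum.IsInternal V :=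
    LinearMap.IsSymmetric.directSum_isInternal_of_pairwise_commute hT fun l m _ => hTC l m
  have : Finite {χ // V χ ≠ ⊥} :=
    WellFoundedGT.finite_ne_bot_of_iSupIndep hV.submodule_iSupIndep
  have := Fintype.ofFinite {χ // V χ ≠ ⊥}
  have hW : DirectSum.IsInternal fun χ : {χ // V χ ≠ ⊥} => V χ :=
    DirectSum.isInternal_ne_bot_iff.2 hV
  have hW' := hV'.comp (Subtype.val_injective (p := fun χ => V χ ≠ ⊥))
  have hn : Module.finrank ℝ (EuclideanSpace ℝ (Fin n)) = n := by simp
  refine ⟨hW.subordinateOrthonormalBasis hn hW',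
    fun l q => (hW.subordinateOrthonormalBasisIndex hn q hW').1 l, fun l q => ?_⟩
  have h := Module.End.mem_eigenspace_iff.1 ((Submodule.mem_iInf _).1
    (hW.subordinateOrthonormalBasis_subordinate hn q hW') l)
  simpa [T, toLpLin_apply] using congrArg WithLp.ofLp h

/-- A commuting family of symmetric real matrices is simultaneously orthogonally
diagonalizable. -/
theorem exists_orthogonal_diagonalization_of_commute_s12 {ι : Type*} [Finite ι] {n : ℕ}
    (D : ι → Matrix (Fin n) (Fin n) ℝ) (hD : ∀ l, (D l).IsSymm)
    (hC : ∀ l m, Commute (D l) (D m)) :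
    ∃ U : Matrix (Fin n) (Fin n) ℝ, U * Uᵀ = 1 ∧
      ∃ c : ι → Fin n → ℝ, ∀ l, D l = Uᵀ * diagonal (c l) * U := by
  obtain ⟨b, c, hbc⟩ := exists_orthonormalBasis_eigenvectors_of_commute D hD hC
  let U : Matrix (Fin n) (Fin n) ℝ := of fun q i => b q i
  have hU : U * Uᵀ = 1 := by
    ext p q
    have h := orthonormal_iff_ite.1 b.orthonormal p q
    rw [PiLp.inner_apply] at h
    simpa [U, mul_apply, one_apply, mul_comm] using h
  refine ⟨U, hU, c, fun l => ?_⟩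
  have hDU : D l * Uᵀ = Uᵀ * diagonal (c l) := by
    ext i q
    rw [mul_diagonal]
    simpa [U, mul_apply, mulVec, dotProduct, mul_comm] using congrFun (hbc l q) i
  rw [← hDU, Matrix.mul_assoc, mul_eq_one_comm.1 hU, Matrix.mul_one]

theorem frobInner_eq_trace (a b : Matrix (Fin 3) (Fin 3) ℝ) :
    frobInner a b = (a * bᵀ).trace := by
  simp [frobInner, trace, mul_apply]

/-- The Frobenius inner product is invariant under orthogonal conjugation. -/
theorem frobInner_conj_diagonal {U : Matrix (Fin 3) (Fin 3) ℝ} (hU : U * Uᵀ = 1)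
    (x y : Fin 3 → ℝ) :
    frobInner (Uᵀ * diagonal x * U) (Uᵀ * diagonal y * U) = ∑ q, x q * y q := by
  have h : Uᵀ * diagonal x * U * (Uᵀ * diagonal y * U)ᵀ
      = Uᵀ * (diagonal x * (U * Uᵀ) * diagonal y * U) := by
    simp [Matrix.mul_assoc]
  rw [frobInner_eq_trace, h, trace_mul_comm, Matrix.mul_assoc, hU]
  simp [trace]

/-- If `dᵃ, dᵇ, dᶜ` are symmetric real 3×3 matrices, Frobenius-orthonormal and
pairwise commuting, then there is an orthonormal basis `(r₁, r₂, r₃)` of ℝ³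
such that the 4th-order tensor `A = dᵃ⊗dᵃ + dᵇ⊗dᵇ + dᶜ⊗dᶜ` satisfies
`A i j k l = ∑ q, (r q) i * (r q) j * (r q) k * (r q) l`. -/
theorem commuting_orthonormal_eigentensors_give_cross
    (da db dc : Matrix (Fin 3) (Fin 3) ℝ)
    (hda : daᵀ = da) (hdb : dbᵀ = db) (hdc : dcᵀ = dc)
    (haa : frobInner da da = 1) (hbb : frobInner db db = 1)
    (hcc : frobInner dc dc = 1)
    (hab : frobInner da db = 0) (hac : frobInner da dc = 0)
    (hbc : frobInner db dc = 0)
    (hcab : da * db = db * da) (hcac : da * dc = dc * da)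
    (hcbc : db * dc = dc * db) :
    ∃ r : Fin 3 → (Fin 3 → ℝ),
      (∀ p q : Fin 3,
        ∑ i : Fin 3, r p i * r q i = if p = q then (1 : ℝ) else 0) ∧
      (∀ i j k l : Fin 3,
        da i j * da k l + db i j * db k l + dc i j * dc k l =
          ∑ q : Fin 3, r q i * r q j * r q k * r q l) := by
  let D : Fin 3 → Matrix (Fin 3) (Fin 3) ℝ := ![da, db, dc]
  obtain ⟨U, hU, c, hc⟩ := exists_orthogonal_diagonalization_of_commute_s12 D
    (fun l => by fin_cases l <;> assumption)
    (fun l m => by fin_cases l <;> fin_cases m <;> simp [D, commute_iff_eq, hcab, hcac, hcbc])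
  have hcomm : ∀ x y, frobInner x y = frobInner y x := fun x y => by
    simp only [frobInner, mul_comm]
  have hD : ∀ l m, frobInner (D l) (D m) = if l = m then 1 else 0 := fun l m => by
    fin_cases l <;> fin_cases m <;>
      simp [D, haa, hbb, hcc, hab, hac, hbc, hcomm db da, hcomm dc da, hcomm dc db]
  have hrow : of c * (of c)ᵀ = 1 := by
    ext l m
    rw [mul_apply, one_apply, ← hD l m, hc l, hc m, frobInner_conj_diagonal hU]
    rfl
  have hcol : (of c)ᵀ * of c = 1 := mul_eq_one_comm.1 hrow
  refine ⟨U, fun p q => ?_, fun i j k l => ?_⟩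
  · simpa [mul_apply, one_apply] using congrFun (congrFun hU p) q
  · have hentry : ∀ m i j, D m i j = ∑ q, c m q * (U q i * U q j) := fun m i j => by
      rw [hc m, mul_apply]
      simp only [mul_diagonal, transpose_apply]
      exact Finset.sum_congr rfl fun q _ => by ring
    calc da i j * da k l + db i j * db k l + dc i j * dc k l
        = ∑ m, D m i j * D m k l :=
          (Fin.sum_univ_three fun m => D m i j * D m k l).symm
      _ = ∑ p, ∑ q, ((of c)ᵀ * of c) p q * (U p i * U p j * (U q k * U q l)) := by
        simp only [hentry, mul_apply, transpose_apply, of_apply, Finset.sum_mul]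
        rw [Finset.sum_comm]
        refine Finset.sum_congr rfl fun p _ => ?_
        simp only [Finset.mul_sum]
        rw [Finset.sum_comm]
        exact Finset.sum_congr rfl fun q _ => Finset.sum_congr rfl fun m _ => by ring
      _ = ∑ q, U q i * U q j * U q k * U q l := by
        simp [hcol, one_apply, mul_assoc]
end
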